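/- Let X be a nonempty compact metric space, T : X → X a continuous map, μ a Borel probability measure on X, and (n_k) a strictly increasing sequence of natural numbers such that the pushforward measures (T^{n_k})_* μ converge in the weak* topology to a Borel probability measure ν. Then supp ν ⊆ Cl( ⋃_{u ∈ supp μ} ω(u) ), where ω(u) := { v ∈ X : T^{m_j} u → v for some strictly increasing sequence (m_j) of natural numbers } and Cl denotes closure in X. -/

import Mathlib

open MeasureTheory Filter

/-- The support of a Borel measure: the set of points all of whose open
neighbourhoods have positive measure. -/
def measSupport {X : Type*} [TopologicalSpace X] [MeasurableSpace X]
    (μ : Measure X) : Set X :=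
  {x | ∀ U : Set X, IsOpen U → x ∈ U → 0 < μ U}

/-- The ω-limit set of a point `u` under the map `T`. -/
def omegaLimitSet {X : Type*} [TopologicalSpace X] (T : X → X) (u : X) : Set X :=
  {v | ∃ m : ℕ → ℕ, StrictMono m ∧ Tendsto (fun j => T^[m j] u) atTop (nhds v)}

theorem measSupport_eq_support {X : Type*} [TopologicalSpace X] [MeasurableSpace X]
    (μ : Measure X) : measSupport μ = μ.support := by
  ext x
  rw [Measure.mem_support_iff_forall]
  constructor
  · intro h U hU
    obtain ⟨V, hVU, hV, hxV⟩ := mem_nhds_iff.1 hU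
    exact (h V hV hxV).trans_le (measure_mono hVU)
  · intro h U hU hxU
    exact h U (hU.mem_nhds hxU)

/-- A continuous function vanishing on the ω-limit set of `u` tends to zero along the orbit. -/
theorem tendsto_iterate_of_eq_zero_on_omegaLimitSet {X : Type*} [MetricSpace X] [CompactSpace X]
    {T : X → X} {u : X} {f : X → ℝ} (hf : Continuous f)
    (h : ∀ w ∈ omegaLimitSet T u, f w = 0) :
    Tendsto (fun k => f (T^[k] u)) atTop (nhds 0) := by
  refine tendsto_of_subseq_tendsto fun ns hns => ?_
  obtain ⟨φ, -, hφ⟩ := strictMono_subseq_of_tendsto_atTop hns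
  obtain ⟨w, ψ, hψ, hw⟩ := CompactSpace.tendsto_subseq (fun k => T^[ns (φ k)] u)
  refine ⟨φ ∘ ψ, ?_⟩
  rw [← h w ⟨_, hφ.comp hψ, hw⟩]
  exact (hf.tendsto w).comp hw

theorem stmt_17 {X : Type*} [MetricSpace X] [CompactSpace X] [Nonempty X]
    [MeasurableSpace X] [BorelSpace X]
    (T : X → X) (hT : Continuous T)
    (μ ν : Measure X) [IsProbabilityMeasure μ] [IsProbabilityMeasure ν]
    (n : ℕ → ℕ) (hn : StrictMono n)
    (hconv : ∀ f : C(X, ℝ),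
      Tendsto (fun k => ∫ x, f x ∂(Measure.map (T^[n k]) μ)) atTop
        (nhds (∫ x, f x ∂ν))) :
    measSupport ν ⊆ closure (⋃ u ∈ measSupport μ, omegaLimitSet T u) := by
  intro v hv
  rw [Metric.mem_closure_iff]
  by_contra! hfar
  obtain ⟨ε, hε, hfar⟩ := hfar
  let f : C(X, ℝ) := ⟨fun x => max 0 (ε - dist v x), by fun_prop⟩
  have hf0 : ∀ x, 0 ≤ f x := fun x => le_max_left _ _
  have hfε : ∀ x, ‖f x‖ ≤ ε := fun x => by
    rw [Real.norm_of_nonneg (hf0 x)]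
    exact max_le hε.le (sub_le_self _ dist_nonneg)
  have hlim : Tendsto (fun k => ∫ x, f (T^[n k] x) ∂μ) atTop (nhds (∫ _, (0 : ℝ) ∂μ)) := by
    refine tendsto_integral_of_dominated_convergence (fun _ => ε)
      (fun k => (f.continuous.comp (hT.iterate _)).aestronglyMeasurable)
      (integrable_const ε) (fun k => ae_of_all _ fun x => hfε _) ?_
    filter_upwards [Measure.support_mem_ae (μ := μ)] with u hu
    rw [← measSupport_eq_support] at hu
    refine (tendsto_iterate_of_eq_zero_on_omegaLimitSet f.continuous fun w hw => ?_).comp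
      hn.tendsto_atTop
    exact max_eq_left (sub_nonpos.2 (hfar w (Set.mem_biUnion hu hw)))
  have hmap : ∀ k, ∫ x, f x ∂(Measure.map (T^[n k]) μ) = ∫ x, f (T^[n k] x) ∂μ := fun k =>
    integral_map (hT.iterate _).aemeasurable f.continuous.aestronglyMeasurable
  have hint : ∫ x, f x ∂ν = 0 := by
    simpa using tendsto_nhds_unique (hconv f) (hlim.congr fun k => (hmap k).symm)
  have hfi : Integrable f ν :=
    (integrable_const ε).mono' f.continuous.aestronglyMeasurable (ae_of_all _ hfε)
  have hae : f =ᵐ[ν] 0 := (integral_eq_zero_iff_of_nonneg hf0 hfi).1 hint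
  have hpos : 0 < ν {x | f x ≠ 0} :=
    hv _ (isOpen_ne_fun f.continuous continuous_const) (by simp [f, hε])
  exact hpos.ne' (ae_iff.1 hae)
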